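/- Suppose: (Randomization) under P(·|S = e), D is independent of the pair (Y(0), Y(1)); (Positivity) P(S = e, D = d, Y = y) > 0 and P(S = o, Y = y) > 0 for all d, y ∈ {0, 1}; (Stability) R is conditionally independent of S given (D, Y); (No direct effect) R is conditionally independent of D given Y; (Observational sample untreated) P(D = 1, S = o) = 0; (Sample exchangeability) the joint law of (Y, R) under P(·|S = e, D = d) equals the joint law of (Y, R) under P(·|S = o, D = d) whenever both conditioning events have positive probability; (Absolute continuity) law(R | D = 1) ≪ law(R | D = 0) and law(R | Y = 1, S = e) ≪ law(R | D = 0). Let g : ℛ → [0, 1] be measurable with g ∘ R a version of the conditional expectation of Y given σ(R) under P(·|S = o), and set θ̃ := E[g(R) | D = 1, S = e] − E[g(R) | D = 0, S = e] and θ := E[Y(1) − Y(0) | S = e]. Then, with w(r) := (P(Y(0) = 1 | S = e)/P(Y(1) = 1 | S = e)) · (d law(R | D = 1)/d law(R | D = 0))(r) the Radon–Nikodym derivative version, one has θ̃ − θ = P(Y(1) = 1 | S = e) · ∫_ℛ (w(r) − 1) d law(R | Y = 1, S = e)(r). -/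

import Mathlib

open MeasureTheory ProbabilityTheory

noncomputable section

/-- Sample indicator values: experimental (`e`) or observational (`o`). -/
inductive Sample : Type
  | e
  | o
deriving DecidableEq

instance : MeasurableSpace Sample := ⊤

/-- Real-valued indicator of a boolean (`{0,1}`-valued variable). -/
def b2r (b : Bool) : ℝ := if b then 1 else 0

/-- `CondIndepOf P R V W` : the conditional law of `R` given `V = v, W = w` agrees with
the conditional law of `R` given `V = v`, for all values with positive probability;
this is the notion of "R is conditionally independent of W given V" for variables with
countable ranges. -/
def CondIndepOf {Ω 𝓡 V W : Type*} [MeasurableSpace Ω] [MeasurableSpace 𝓡]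
    (P : Measure Ω) (R : Ω → 𝓡) (Vf : Ω → V) (Wf : Ω → W) : Prop :=
  ∀ v w, 0 < P {ω | Vf ω = v ∧ Wf ω = w} →
    (P[|{ω | Vf ω = v ∧ Wf ω = w}]).map R = (P[|{ω | Vf ω = v}]).map R

section CondLaws

variable {Ω 𝓡 : Type*} [MeasurableSpace Ω] [MeasurableSpace 𝓡]

lemma cond_congr_set {P : Measure Ω} {s t : Set Ω} (h : s =ᵐ[P] t) : P[|s] = P[|t] := by
  rw [ProbabilityTheory.cond, ProbabilityTheory.cond, measure_congr h,
    Measure.restrict_congr_set h]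

lemma smul_map_cond {P : Measure Ω} [IsFiniteMeasure P] (R : Ω → 𝓡) (s : Set Ω) :
    P s • (P[|s]).map R = (P.restrict s).map R := by
  rw [ProbabilityTheory.cond, Measure.map_smul, smul_smul]
  by_cases h : P s = 0
  · simp [h, Measure.restrict_eq_zero.mpr h]
  · rw [ENNReal.mul_inv_cancel h (measure_ne_top _ _), one_smul]

/-- A mixture of two conditional laws that both equal `ν` is `ν`. -/
lemma map_cond_union {P : Measure Ω} [IsFiniteMeasure P] {R : Ω → 𝓡} (hR : Measurable R)
    {s t : Set Ω} (ht : MeasurableSet t) (hst : Disjoint s t) {ν : Measure 𝓡}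
    (h : P (s ∪ t) ≠ 0)
    (hs_law : P s ≠ 0 → (P[|s]).map R = ν) (ht_law : P t ≠ 0 → (P[|t]).map R = ν) :
    (P[|s ∪ t]).map R = ν := by
  have restrict_law (u : Set Ω) (hu : P u ≠ 0 → (P[|u]).map R = ν) :
      (P.restrict u).map R = P u • ν := by
    by_cases h0 : P u = 0
    · simp [h0, Measure.restrict_eq_zero.mpr h0]
    · rw [← smul_map_cond, hu h0]
  rw [ProbabilityTheory.cond, Measure.restrict_union hst ht, Measure.map_smul,
    Measure.map_add _ _ hR, restrict_law s hs_law, restrict_law t ht_law, ← add_smul,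
    ← measure_union hst ht, smul_smul, ENNReal.inv_mul_cancel h (measure_ne_top _ _), one_smul]

lemma IndepFun.cond_preimage_eq {β γ : Type*} [MeasurableSpace β] [MeasurableSpace γ]
    {μ : Measure Ω} [IsFiniteMeasure μ] {X : Ω → β} {Z : Ω → γ} (h : IndepFun X Z μ)
    (hX : Measurable X) {s : Set β} {t : Set γ} (hs : MeasurableSet s) (ht : MeasurableSet t)
    (h0 : μ (X ⁻¹' s) ≠ 0) : (μ[|X ⁻¹' s]) (Z ⁻¹' t) = μ (Z ⁻¹' t) := by
  rw [cond_apply (hX hs), h.measure_inter_preimage_eq_mul s t hs ht, ← mul_assoc,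
    ENNReal.inv_mul_cancel h0 (measure_ne_top _ _), one_mul]

lemma withDensity_ofReal_eq_smul {ν L : Measure 𝓡} [IsFiniteMeasure L]
    {g : 𝓡 → ℝ} (hg : Integrable g ν) (hg0 : ∀ r, 0 ≤ g r) {c : ℝ} (hc : 0 ≤ c)
    (h : ∀ A, MeasurableSet A → ∫ r in A, g r ∂ν = c * L.real A) :
    ν.withDensity (fun r => ENNReal.ofReal (g r)) = ENNReal.ofReal c • L := by
  ext A hA
  rw [withDensity_apply _ hA, ← ofReal_integral_eq_lintegral_ofReal hg.integrableOn
    (Filter.Eventually.of_forall hg0), h A hA, ENNReal.ofReal_mul hc, ofReal_measureReal]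
  rfl

/-- If `g ν = c L` and `μ ≪ ν`, then `∫ g dμ = c ∫ (dμ/dν) dL`. -/
lemma integral_eq_mul_integral_rnDeriv {μ ν L : Measure 𝓡} [IsFiniteMeasure μ]
    [SigmaFinite ν] (hμν : μ ≪ ν) {g : 𝓡 → ℝ} (hg : Measurable g) (hg0 : ∀ r, 0 ≤ g r)
    {c : ℝ} (hc : 0 ≤ c)
    (h : ν.withDensity (fun r => ENNReal.ofReal (g r)) = ENNReal.ofReal c • L) :
    ∫ r, g r ∂μ = c * ∫ r, (μ.rnDeriv ν r).toReal ∂L := by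
  have h1 : ∫ r, (μ.rnDeriv ν r).toReal ∂(ν.withDensity (fun r => ENNReal.ofReal (g r)))
      = c * ∫ r, (μ.rnDeriv ν r).toReal ∂L := by
    rw [h, integral_smul_measure, ENNReal.toReal_ofReal hc, smul_eq_mul]
  rw [← h1, integral_withDensity_eq_integral_toReal_smul hg.ennreal_ofReal (by simp),
    ← integral_toReal_rnDeriv_mul hμν]
  simp_rw [ENNReal.toReal_ofReal (hg0 _), smul_eq_mul, mul_comm]

lemma integrable_rnDeriv_of_withDensity_eq {μ ν L : Measure 𝓡} [IsFiniteMeasure μ]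
    {g : 𝓡 → ℝ} (hg : Measurable g) (hg_range : ∀ r, g r ∈ Set.Icc (0 : ℝ) 1)
    {c : ℝ} (hc : 0 < c)
    (h : ν.withDensity (fun r => ENNReal.ofReal (g r)) = ENNReal.ofReal c • L) :
    Integrable (fun r => (μ.rnDeriv ν r).toReal) L := by
  rw [← integrable_smul_measure (c := ENNReal.ofReal c) (by simpa using hc) (by simp), ← h,
    integrable_withDensity_iff hg.ennreal_ofReal (by simp)]
  refine (Measure.integrable_toReal_rnDeriv (μ := μ) (ν := ν)).mul_bdd
    (c := 1) hg.ennreal_ofReal.ennreal_toReal.aestronglyMeasurable (Filter.Eventually.of_forall fun r => ?_)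
  rw [ENNReal.toReal_ofReal (hg_range r).1, Real.norm_eq_abs, abs_of_nonneg (hg_range r).1]
  exact (hg_range r).2

end CondLaws

lemma integral_b2r {Ω : Type*} [MeasurableSpace Ω] {μ : Measure Ω} {X : Ω → Bool}
    (hX : Measurable X) : ∫ ω, b2r (X ω) ∂μ = μ.real {ω | X ω = true} := by
  have h : (fun ω => b2r (X ω)) = {ω | X ω = true}.indicator 1 := by
    ext ω
    simp [b2r, Set.indicator_apply]
  rw [h]
  exact integral_indicator_one (hX (measurableSet_singleton true))

lemma integrable_b2r {Ω : Type*} [MeasurableSpace Ω] {μ : Measure Ω} [IsFiniteMeasure μ]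
    {X : Ω → Bool} (hX : Measurable X) : Integrable (fun ω => b2r (X ω)) μ := by
  refine .of_bound ((measurable_of_countable b2r).comp hX).aestronglyMeasurable 1
    (Filter.Eventually.of_forall fun ω => ?_)
  unfold b2r
  split_ifs <;> simp

/-- **Proposition (Bias of common practice).**
Using the predicted outcome `g(R)` from the observational sample as the outcome in the
experiment targets `θ̃`, whose bias for the true ATE `θ` is
`θ̃ − θ = P(Y(1)=1|S=e) ∫ (w(r) − 1) d law(R|Y=1,S=e)(r)`, where
`w(r) = (P(Y(0)=1|S=e)/P(Y(1)=1|S=e)) · (d law(R|D=1)/d law(R|D=0))(r)`. -/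
theorem statement4
    {Ω 𝓡 : Type*} [MeasurableSpace Ω] [MeasurableSpace 𝓡] [StandardBorelSpace 𝓡]
    (P : Measure Ω) [IsProbabilityMeasure P]
    (S : Ω → Sample) (D : Ω → Bool) (Y0 Y1 : Ω → Bool) (R : Ω → 𝓡)
    (hS : Measurable S) (hD : Measurable D) (hY0 : Measurable Y0) (hY1 : Measurable Y1)
    (hR : Measurable R)
    (Y : Ω → Bool) (hYdef : ∀ ω, Y ω = if D ω then Y1 ω else Y0 ω)
    -- Randomization: D ⫫ (Y(0), Y(1)) under P(·|S = e)
    (randomization :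
      IndepFun D (fun ω => (Y0 ω, Y1 ω)) (P[|{ω | S ω = Sample.e}]))
    -- Positivity
    (positivity_e : ∀ d y : Bool,
      0 < P {ω | S ω = Sample.e ∧ D ω = d ∧ Y ω = y})
    (positivity_o : ∀ y : Bool, 0 < P {ω | S ω = Sample.o ∧ Y ω = y})
    -- Stability: R ⫫ S | (D, Y)
    (stability : CondIndepOf P R (fun ω => (D ω, Y ω)) S)
    -- No direct effect: R ⫫ D | Y
    (noDirectEffect : CondIndepOf P R Y D)
    -- Observational sample untreated: P(D = 1, S = o) = 0
    (untreated_o : P {ω | D ω = true ∧ S ω = Sample.o} = 0)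
    -- Sample exchangeability: law(Y, R | S = e, D = d) = law(Y, R | S = o, D = d)
    (exchangeability : ∀ d : Bool,
      0 < P {ω | S ω = Sample.e ∧ D ω = d} →
      0 < P {ω | S ω = Sample.o ∧ D ω = d} →
      (P[|{ω | S ω = Sample.e ∧ D ω = d}]).map (fun ω => (Y ω, R ω)) =
        (P[|{ω | S ω = Sample.o ∧ D ω = d}]).map (fun ω => (Y ω, R ω)))
    -- Absolute continuity: law(R|D=1) ≪ law(R|D=0), law(R|Y=1,S=e) ≪ law(R|D=0)
    (ac1 : (P[|{ω | D ω = true}]).map R ≪ (P[|{ω | D ω = false}]).map R)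
    (ac2 : (P[|{ω | Y ω = true ∧ S ω = Sample.e}]).map R ≪
      (P[|{ω | D ω = false}]).map R)
    -- g : ℛ → [0,1] a version of E[Y | σ(R)] under P(·|S = o)
    (g : 𝓡 → ℝ) (hg_meas : Measurable g) (hg_range : ∀ r, g r ∈ Set.Icc (0 : ℝ) 1)
    (hg_ce : (fun ω => g (R ω))
      =ᵐ[P[|{ω | S ω = Sample.o}]]
        (P[|{ω | S ω = Sample.o}])[(fun ω => b2r (Y ω)) |
          MeasurableSpace.comap R inferInstance])
    -- θ̃ := E[g(R) | D = 1, S = e] − E[g(R) | D = 0, S = e]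
    (θt : ℝ)
    (hθt : θt = (∫ ω, g (R ω) ∂(P[|{ω | D ω = true ∧ S ω = Sample.e}])) -
      (∫ ω, g (R ω) ∂(P[|{ω | D ω = false ∧ S ω = Sample.e}])))
    -- θ := E[Y(1) − Y(0) | S = e]
    (θ : ℝ)
    (hθ : θ = ∫ ω, (b2r (Y1 ω) - b2r (Y0 ω)) ∂(P[|{ω | S ω = Sample.e}]))
    -- w(r) := (P(Y(0)=1|S=e)/P(Y(1)=1|S=e)) · (d law(R|D=1)/d law(R|D=0))(r)
    (w : 𝓡 → ℝ)
    (hw : ∀ r, w r =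
      (((P[|{ω | S ω = Sample.e}]) {ω | Y0 ω = true}).toReal /
        ((P[|{ω | S ω = Sample.e}]) {ω | Y1 ω = true}).toReal) *
      (((P[|{ω | D ω = true}]).map R).rnDeriv
        ((P[|{ω | D ω = false}]).map R) r).toReal) :
    θt - θ =
      ((P[|{ω | S ω = Sample.e}]) {ω | Y1 ω = true}).toReal *
        ∫ r, (w r - 1) ∂((P[|{ω | Y ω = true ∧ S ω = Sample.e}]).map R) := by
  have hY : Measurable Y := by
    have : Y = fun ω => if D ω = true then Y1 ω else Y0 ω := funext hYdef
    rw [this]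
    exact Measurable.ite (hD (measurableSet_singleton true)) hY1 hY0
  have mS (s : Sample) : MeasurableSet {ω | S ω = s} := hS (measurableSet_eq (a := s))
  have mD (d : Bool) : MeasurableSet {ω | D ω = d} := hD (measurableSet_singleton d)
  have mY (y : Bool) : MeasurableSet {ω | Y ω = y} := hY (measurableSet_singleton y)
  have posSD (d : Bool) : 0 < P {ω | S ω = Sample.e ∧ D ω = d} :=
    (positivity_e d true).trans_le (measure_mono fun ω h => ⟨h.1, h.2.1⟩)
  have posSe : P {ω | S ω = Sample.e} ≠ 0 :=
    ((posSD true).trans_le (measure_mono fun ω h => h.1)).ne'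
  have posSo : P {ω | S ω = Sample.o} ≠ 0 :=
    ((positivity_o true).trans_le (measure_mono fun ω h => h.1)).ne'
  have not_treated : ∀ᵐ ω ∂P, ¬(D ω = true ∧ S ω = Sample.o) :=
    measure_eq_zero_iff_ae_notMem.mp untreated_o
  set L := (P[|{ω | Y ω = true}]).map R
  -- The law of `R` given treatment, outcome and sample depends on the outcome only.
  have law_cell (d : Bool) (s : Sample)
      (h : P {ω | (D ω, Y ω) = (d, true) ∧ S ω = s} ≠ 0) :
      (P[|{ω | (D ω, Y ω) = (d, true) ∧ S ω = s}]).map R = L := by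
    rw [stability (d, true) s (pos_iff_ne_zero.mpr h)]
    have hset : {ω | (D ω, Y ω) = (d, true)} = {ω | Y ω = true ∧ D ω = d} := by
      ext ω; simp [and_comm]
    rw [hset]
    refine noDirectEffect true d (pos_iff_ne_zero.mpr fun h0 => h ?_)
    refine measure_mono_null ?_ h0
    exact fun ω hω => ⟨congrArg Prod.snd hω.1, congrArg Prod.fst hω.1⟩
  have law_Y1_e : (P[|{ω | Y ω = true ∧ S ω = Sample.e}]).map R = L := by
    have hset : {ω | Y ω = true ∧ S ω = Sample.e} =
        {ω | (D ω, Y ω) = (true, true) ∧ S ω = Sample.e} ∪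
          {ω | (D ω, Y ω) = (false, true) ∧ S ω = Sample.e} := by
      ext ω; cases hd : D ω <;> simp [hd]
    have m : MeasurableSet {ω | (D ω, Y ω) = (false, true) ∧ S ω = Sample.e} :=
      ((hD.prodMk hY) (measurableSet_singleton _)).inter (mS _)
    rw [hset]
    refine map_cond_union hR m ?_ ?_ (law_cell _ _) (law_cell _ _)
    · rw [Set.disjoint_left]; simp_all
    · rw [← hset]
      refine ((positivity_e true true).trans_le (measure_mono ?_)).ne'
      exact fun ω hω => ⟨hω.2.2, hω.1⟩
  set Po := P[|{ω | S ω = Sample.o}] with hPo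
  set Pe := P[|{ω | S ω = Sample.e}] with hPe
  have : IsProbabilityMeasure Po := cond_isProbabilityMeasure posSo
  have : IsProbabilityMeasure Pe := cond_isProbabilityMeasure posSe
  have So_ae : {ω | S ω = Sample.o} =ᵐ[P] {ω | S ω = Sample.o ∧ D ω = false} := by
    filter_upwards [not_treated] with ω hω
    refine propext ⟨fun h => ⟨h, ?_⟩, fun h => h.1⟩
    by_contra hd
    exact hω ⟨by simpa using hd, h⟩
  have Po_eq : Po = P[|{ω | S ω = Sample.o ∧ D ω = false}] := cond_congr_set So_ae
  have exch := exchangeability false (posSD false)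
    (by rw [← measure_congr So_ae]; exact pos_iff_ne_zero.mpr posSo)
  rw [← Po_eq] at exch
  have exchR : (P[|{ω | S ω = Sample.e ∧ D ω = false}]).map R = Po.map R := by
    have := congrArg (Measure.map Prod.snd) exch
    rwa [Measure.map_map measurable_snd (hY.prodMk hR),
      Measure.map_map measurable_snd (hY.prodMk hR)] at this
  have exchY : (P[|{ω | S ω = Sample.e ∧ D ω = false}]) {ω | Y ω = true}
      = Po {ω | Y ω = true} := by
    have := congrArg (fun μ => μ (Prod.fst ⁻¹' {true})) exch
    rwa [Measure.map_apply (hY.prodMk hR) (measurable_fst (measurableSet_singleton _)),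
      Measure.map_apply (hY.prodMk hR) (measurable_fst (measurableSet_singleton _))] at this
  have law_D0 : (P[|{ω | D ω = false}]).map R = Po.map R := by
    have hset : {ω | D ω = false} =
        {ω | S ω = Sample.e ∧ D ω = false} ∪ {ω | S ω = Sample.o ∧ D ω = false} := by
      ext ω; cases hs : S ω <;> simp [hs]
    rw [hset]
    have m : MeasurableSet {ω | S ω = Sample.o ∧ D ω = false} := (mS _).inter (mD _)
    refine map_cond_union hR m ?_ ?_ (fun _ => exchR) (fun _ => by rw [Po_eq])
    · rw [Set.disjoint_left]; simp_all
    · rw [← hset]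
      exact ((posSD false).trans_le (measure_mono fun ω h => h.2)).ne'
  have law_D1 : P[|{ω | D ω = true ∧ S ω = Sample.e}] = P[|{ω | D ω = true}] := by
    refine cond_congr_set ?_
    filter_upwards [not_treated] with ω hω
    refine propext ⟨fun h => h.1, fun h => ⟨h, ?_⟩⟩
    cases hs : S ω
    · rfl
    · exact absurd ⟨h, hs⟩ hω
  -- Randomization identifies the untreated outcome mean in both samples.
  have rand : Pe {ω | Y0 ω = true} = Po {ω | Y ω = true} := by
    rw [← exchY]
    have h0 : Pe (D ⁻¹' {false}) ≠ 0 := by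
      rw [hPe]
      exact (cond_pos_of_inter_ne_zero (mS _) (posSD false).ne').ne'
    have h1 := IndepFun.cond_preimage_eq randomization hD (measurableSet_singleton false)
      (measurable_fst (measurableSet_singleton true)) h0
    have h2 : Pe[|D ⁻¹' {false}] = P[|{ω | S ω = Sample.e ∧ D ω = false}] :=
      cond_cond_eq_cond_inter (mS _) (mD _) P
    rw [h2] at h1
    refine h1.symm.trans (measure_congr ?_)
    filter_upwards [ae_cond_mem ((mS Sample.e).inter (mD false))] with ω hω
    have hd : D ω = false := hω.2
    refine propext (?_ : Y0 ω = true ↔ Y ω = true)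
    simp [hYdef, hd]
  have Po_pos : Po {ω | Y ω = true} ≠ 0 := by
    rw [hPo]
    exact (cond_pos_of_inter_ne_zero (mS _) (positivity_o true).ne').ne'
  have q0_pos : 0 < Po.real {ω | Y ω = true} := ENNReal.toReal_pos Po_pos (measure_ne_top _ _)
  have q1_pos : 0 < Pe.real {ω | Y1 ω = true} := by
    refine ENNReal.toReal_pos ?_ (measure_ne_top _ _)
    rw [hPe]
    refine (cond_pos_of_inter_ne_zero (mS _) ?_).ne'
    refine ((positivity_e true true).trans_le (measure_mono ?_)).ne'
    rintro ω ⟨hs, hd, hy⟩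
    exact ⟨hs, by simpa [hYdef, hd] using hy⟩
  have law_Po_Y1 : (Po[|{ω | Y ω = true}]).map R = L := by
    rw [hPo, cond_cond_eq_cond_inter (mS _) (mY _)]
    have hae : ({ω | S ω = Sample.o} ∩ {ω | Y ω = true} : Set Ω) =ᵐ[P]
        {ω | (D ω, Y ω) = (false, true) ∧ S ω = Sample.o} := by
      filter_upwards [not_treated] with ω hω
      refine propext (?_ : S ω = Sample.o ∧ Y ω = true ↔
        (D ω, Y ω) = (false, true) ∧ S ω = Sample.o)
      cases hd : D ω <;> simp_all [and_comm]
    rw [cond_congr_set hae]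
    refine law_cell _ _ ?_
    rw [← measure_congr hae]
    exact (positivity_o true).ne'
  have : IsProbabilityMeasure L := by
    rw [← law_Po_Y1]
    have : IsProbabilityMeasure (Po[|{ω | Y ω = true}]) := cond_isProbabilityMeasure Po_pos
    exact Measure.isProbabilityMeasure_map hR.aemeasurable
  have : IsProbabilityMeasure (Po.map R) := Measure.isProbabilityMeasure_map hR.aemeasurable
  have g_int (μ : Measure 𝓡) [IsFiniteMeasure μ] : Integrable g μ :=
    .of_bound hg_meas.aestronglyMeasurable 1 (Filter.Eventually.of_forall fun r => by
      rw [Real.norm_eq_abs, abs_of_nonneg (hg_range r).1]; exact (hg_range r).2)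
  have g_set (A : Set 𝓡) (hA : MeasurableSet A) :
      ∫ r in A, g r ∂(Po.map R) = Po.real {ω | Y ω = true} * L.real A := by
    rw [setIntegral_map hA hg_meas.aestronglyMeasurable hR.aemeasurable,
      setIntegral_congr_ae (hR hA) (hg_ce.mono fun _ h _ => h),
      setIntegral_condExp hR.comap_le (integrable_b2r hY) ⟨A, hA, rfl⟩, integral_b2r hY,
      ← law_Po_Y1, measureReal_def, measureReal_def, measureReal_def, ← ENNReal.toReal_mul,
      Measure.map_apply hR hA, mul_comm, cond_mul_eq_inter (mY true),
      Measure.restrict_apply (mY true)]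
  have g_dens := withDensity_ofReal_eq_smul (g_int (Po.map R)) (fun r => (hg_range r).1)
    q0_pos.le g_set
  have g_total : ∫ r, g r ∂(Po.map R) = Po.real {ω | Y ω = true} := by
    have := g_set Set.univ MeasurableSet.univ
    simpa using this
  have g_D1 := integral_eq_mul_integral_rnDeriv (law_D0 ▸ ac1) hg_meas
    (fun r => (hg_range r).1) q0_pos.le g_dens
  have rn_int := integrable_rnDeriv_of_withDensity_eq (μ := (P[|{ω | D ω = true}]).map R)
    hg_meas hg_range q0_pos g_dens
  have D0_comm : {ω | D ω = false ∧ S ω = Sample.e} = {ω | S ω = Sample.e ∧ D ω = false} := by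
    ext ω; exact and_comm
  have θ_eq : θ = Pe.real {ω | Y1 ω = true} - Po.real {ω | Y ω = true} := by
    rw [hθ, integral_sub (integrable_b2r hY1) (integrable_b2r hY0), integral_b2r hY1,
      integral_b2r hY0, measureReal_def (s := {ω | Y0 ω = true}), rand, ← measureReal_def]
  have θt_eq : θt = Po.real {ω | Y ω = true} *
      ∫ r, (((P[|{ω | D ω = true}]).map R).rnDeriv (Po.map R) r).toReal ∂L -
        Po.real {ω | Y ω = true} := by
    rw [hθt, law_D1, D0_comm, ← g_D1, ← g_total, ← exchR,
      integral_map hR.aemeasurable hg_meas.aestronglyMeasurable,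
      integral_map hR.aemeasurable hg_meas.aestronglyMeasurable]
  rw [law_Y1_e, θ_eq, θt_eq]
  simp_rw [hw, law_D0, rand, ← measureReal_def]
  rw [integral_sub (rn_int.const_mul _) (integrable_const _), integral_const_mul]
  simp only [integral_const, probReal_univ, smul_eq_mul]
  field_simp
  ring
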